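/- Let k ≥ 2 and let T be a k-regular tree with covariance matrix C and Haar-like matrix Φ, and let ζ denote the fraction of vanishing entries of the |L|×|L| matrix Φ'CΦ. Then 1 − ζ ≤ (k−1)²/|I| + 2(k−1)²·IPL(T)/|I|². -/

import Mathlib

/-- A finite rooted tree, encoded by a parent function together with a depth
function certifying acyclicity and connectivity to the root. -/
structure FinRootedTree where
  V : Type
  fintypeV : Fintype V
  decEqV : DecidableEq V
  root : V
  parent : V → V
  parent_root : parent root = root
  depth : V → ℕ
  depth_eq_zero : ∀ v : V, depth v = 0 ↔ v = root
  depth_parent : ∀ v : V, v ≠ root → depth (parent v) + 1 = depth v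

attribute [instance] FinRootedTree.fintypeV FinRootedTree.decEqV

namespace FinRootedTree

variable (T : FinRootedTree)

/-- The children of a vertex. -/
def children (v : T.V) : Finset T.V :=
  Finset.univ.filter fun u => u ≠ T.root ∧ T.parent u = v

/-- A vertex is a leaf when it has no children. -/
def IsLeaf (v : T.V) : Prop := T.children v = ∅

instance : DecidablePred T.IsLeaf := fun v =>
  decidable_of_iff (T.children v = ∅) Iff.rfl

/-- The set of leaves. -/
def leaves : Finset T.V := Finset.univ.filter fun v => T.IsLeaf v

/-- The set of interior nodes. -/
def interior : Finset T.V := Finset.univ.filter fun v => ¬ T.IsLeaf v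

/-- The ancestors of `v`, including `v` itself. -/
def ancSelf (v : T.V) : Finset T.V :=
  (Finset.range (Fintype.card T.V + 1)).image (fun m => T.parent^[m] v)

/-- The edges on the path from `v` to the root; each edge is identified with
its endpoint farther from the root. -/
def edgesToRoot (v : T.V) : Finset T.V := (T.ancSelf v).erase T.root

/-- The edges on the path between `u` and `v`. -/
def pathEdges (u v : T.V) : Finset T.V :=
  (T.edgesToRoot u \ T.edgesToRoot v) ∪ (T.edgesToRoot v \ T.edgesToRoot u)

/-- The leaves of the subtree rooted at `v`. -/
def leavesBelow (v : T.V) : Finset T.V := T.leaves.filter fun i => v ∈ T.ancSelf i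

/-- The phylogenetic covariance matrix: `cov ℓ i j = ∑_{e ∈ [i∧j, ∘]} ℓ(e)`
(the edges from the least common ancestor of `i` and `j` to the root are
exactly the common ancestors of `i` and `j` other than the root). -/
def cov (ℓ : T.V → ℝ) (i j : T.V) : ℝ :=
  ∑ w ∈ T.edgesToRoot i ∩ T.edgesToRoot j, ℓ w

/-- The trace length `ℓ*(u,v) = ∑_{e ∈ [u,v]} |L(e)| ℓ(e)`. -/
def traceLength (ℓ : T.V → ℝ) (u v : T.V) : ℝ :=
  ∑ w ∈ T.pathEdges u v, ((T.leavesBelow w).card : ℝ) * ℓ w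

/-- Internal path length: the sum of the depths of the interior nodes. -/
def IPL : ℕ := ∑ v ∈ T.interior, T.depth v

/-- `T` is `k`-regular: the root has exactly one child and every other
interior node has exactly `k` children. -/
def IsKRegular (k : ℕ) : Prop :=
  (T.children T.root).card = 1 ∧
    ∀ v : T.V, v ≠ T.root → ¬ T.IsLeaf v → (T.children v).card = k

end FinRootedTree

/-- A `k`-regular structure on a finite rooted tree: an ordering of the
children of each interior non-root node by `{0, …, k-1}` (index `i`
corresponds to the child `v_{i+1}` of the paper), the root having degree
one. -/
structure KRegStruct (k : ℕ) (T : FinRootedTree) where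
  child : T.V → ℕ → T.V
  root_deg : (T.children T.root).card = 1
  child_mem : ∀ v : T.V, v ≠ T.root → ¬ T.IsLeaf v → ∀ i < k, child v i ∈ T.children v
  child_inj : ∀ v : T.V, v ≠ T.root → ¬ T.IsLeaf v →
      ∀ i < k, ∀ j < k, child v i = child v j → i = j
  child_surj : ∀ v : T.V, v ≠ T.root → ¬ T.IsLeaf v →
      ∀ u ∈ T.children v, ∃ i < k, child v i = u

/-- The mother wavelet `φ_∘` of a tree. -/
noncomputable def FinRootedTree.rootWavelet (T : FinRootedTree) : T.V → ℝ :=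
  fun _ => 1 / Real.sqrt ((T.leaves.card : ℝ))

/-- The index set of the Haar-like wavelets: the root index `none` together
with the pairs `(v, n)` for `v` an interior non-root node and `1 ≤ n < k`. -/
def FinRootedTree.waveletIdx (k : ℕ) (T : FinRootedTree) : Finset (Option (T.V × ℕ)) :=
  insert none (((T.interior.erase T.root) ×ˢ Finset.Ico 1 k).image some)

namespace KRegStruct

variable {k : ℕ} {T : FinRootedTree} (R : KRegStruct k T)

/-- `L_{v,n}`: the leaves below the first `n` children of `v`. -/
def Lpart (v : T.V) (n : ℕ) : Finset T.V :=
  (Finset.range n).biUnion fun j => T.leavesBelow (R.child v j)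

/-- `L(v_{n+1})`: the leaves below the `(n+1)`-st child of `v`. -/
def Lnext (v : T.V) (n : ℕ) : Finset T.V := T.leavesBelow (R.child v n)

/-- The Haar-like wavelet `φ_{v,n}`. -/
noncomputable def wavelet (v : T.V) (n : ℕ) : T.V → ℝ := fun i =>
  if i ∈ R.Lpart v n then
    Real.sqrt (((R.Lnext v n).card : ℝ) /
      (((R.Lpart v n).card : ℝ) * (((R.Lpart v n ∪ R.Lnext v n)).card : ℝ)))
  else if i ∈ R.Lnext v n then
    - Real.sqrt (((R.Lpart v n).card : ℝ) /
      (((R.Lnext v n).card : ℝ) * (((R.Lpart v n ∪ R.Lnext v n)).card : ℝ)))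
  else 0

/-- `ψ` is a Haar-like wavelet associated with the node `v`. -/
def IsWaveletAt (v : T.V) (ψ : T.V → ℝ) : Prop :=
  (v = T.root ∧ ψ = T.rootWavelet) ∨
    (v ≠ T.root ∧ ∃ n : ℕ, 1 ≤ n ∧ n < k ∧ ψ = R.wavelet v n)

/-- The family of all Haar-like wavelets, as indexed above (the columns of the
Haar-like matrix `Φ`). -/
noncomputable def waveFun : Option (T.V × ℕ) → T.V → ℝ
  | none => T.rootWavelet
  | some (v, n) => R.wavelet v n

/-- The entry of `Φ' C Φ` in row `a` and column `b`. -/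
noncomputable def entry (ℓ : T.V → ℝ) (a b : Option (T.V × ℕ)) : ℝ :=
  ∑ j ∈ T.leaves, ∑ i ∈ T.leaves, R.waveFun a j * T.cov ℓ j i * R.waveFun b i

open Classical in
/-- `ζ`: the fraction of vanishing entries of the `|L| × |L|` matrix `Φ' C Φ`. -/
noncomputable def zeta (ℓ : T.V → ℝ) : ℝ :=
  ((((T.waveletIdx k ×ˢ T.waveletIdx k).filter fun p => R.entry ℓ p.1 p.2 = 0).card : ℝ)) /
    ((T.leaves.card : ℝ)) ^ 2

end KRegStruct

namespace FinRootedTree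

variable (T : FinRootedTree)

lemma depth_iter (v : T.V) (m : ℕ) : T.depth (T.parent^[m] v) = T.depth v - m := by
  induction m with
  | zero => simp
  | succ m ih =>
    rw [Function.iterate_succ_apply']
    by_cases h : T.parent^[m] v = T.root
    · have h0 : T.depth T.root = 0 := (T.depth_eq_zero _).2 rfl
      rw [h, h0] at ih
      rw [h, T.parent_root, h0]
      omega
    · have := T.depth_parent _ h
      omega

lemma iter_ge (v : T.V) (m : ℕ) (h : T.depth v ≤ m) : T.parent^[m] v = T.root := by
  rw [← T.depth_eq_zero, depth_iter]; omega

lemma depth_lt_card (v : T.V) : T.depth v < Fintype.card T.V := by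
  have h : (Finset.range (T.depth v + 1)).card ≤ (Finset.univ : Finset T.V).card := by
    apply Finset.card_le_card_of_injOn (fun m => T.parent^[m] v) (by intro x _; simp)
    intro a ha b hb hab
    have ha' : a < T.depth v + 1 := by simpa using ha
    have hb' : b < T.depth v + 1 := by simpa using hb
    have h1 := congrArg T.depth hab
    simp only [depth_iter] at h1
    omega
  rw [Finset.card_range, Finset.card_univ] at h
  omega

lemma mem_anc' {u v : T.V} :
    u ∈ T.ancSelf v ↔ ∃ m, m ≤ T.depth v ∧ T.parent^[m] v = u := by
  have hd := T.depth_lt_card v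
  constructor
  · intro h
    simp only [ancSelf, Finset.mem_image, Finset.mem_range] at h
    obtain ⟨m, _, h⟩ := h
    by_cases hm : m ≤ T.depth v
    · exact ⟨m, hm, h⟩
    · refine ⟨T.depth v, le_rfl, ?_⟩
      rw [← h, T.iter_ge v _ le_rfl, T.iter_ge v m (by omega)]
  · rintro ⟨m, hm, h⟩
    simp only [ancSelf, Finset.mem_image, Finset.mem_range]
    exact ⟨m, by omega, h⟩

lemma mem_anc {u v : T.V} : u ∈ T.ancSelf v ↔ ∃ m, T.parent^[m] v = u := by
  constructor
  · intro h
    obtain ⟨m, _, h⟩ := T.mem_anc'.1 h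
    exact ⟨m, h⟩
  · rintro ⟨m, h⟩
    rw [mem_anc']
    by_cases hm : m ≤ T.depth v
    · exact ⟨m, hm, h⟩
    · refine ⟨T.depth v, le_rfl, ?_⟩
      rw [← h, T.iter_ge v _ le_rfl, T.iter_ge v m (by omega)]

lemma anc_refl (v : T.V) : v ∈ T.ancSelf v := T.mem_anc.2 ⟨0, rfl⟩

lemma root_anc (v : T.V) : T.root ∈ T.ancSelf v :=
  T.mem_anc.2 ⟨T.depth v, T.iter_ge v _ le_rfl⟩

lemma anc_trans {u v w : T.V} (h1 : u ∈ T.ancSelf v) (h2 : v ∈ T.ancSelf w) :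
    u ∈ T.ancSelf w := by
  rw [mem_anc] at *
  obtain ⟨m, rfl⟩ := h1
  obtain ⟨n, rfl⟩ := h2
  exact ⟨m + n, Function.iterate_add_apply _ _ _ _⟩

lemma anc_total {x y i : T.V} (hx : x ∈ T.ancSelf i) (hy : y ∈ T.ancSelf i) :
    x ∈ T.ancSelf y ∨ y ∈ T.ancSelf x := by
  rw [mem_anc] at hx hy
  obtain ⟨m, rfl⟩ := hx
  obtain ⟨n, rfl⟩ := hy
  rcases le_total m n with h | h
  · right
    rw [mem_anc]
    refine ⟨n - m, ?_⟩
    rw [← Function.iterate_add_apply]; congr; omega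
  · left
    rw [mem_anc]
    refine ⟨m - n, ?_⟩
    rw [← Function.iterate_add_apply]; congr; omega

lemma anc_depth_eq {x y : T.V} (h : x ∈ T.ancSelf y) (hd : T.depth x = T.depth y) : x = y := by
  obtain ⟨m, hm, rfl⟩ := T.mem_anc'.1 h
  rw [depth_iter] at hd
  have : m = 0 := by omega
  subst this; rfl

lemma card_anc_le (v : T.V) : ((T.ancSelf v).erase v).card ≤ T.depth v := by
  rw [Finset.card_erase_of_mem (T.anc_refl v)]
  have : T.ancSelf v ⊆ (Finset.range (T.depth v + 1)).image (fun m => T.parent^[m] v) := by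
    intro u hu
    obtain ⟨m, hm, h⟩ := T.mem_anc'.1 hu
    simp only [Finset.mem_image, Finset.mem_range]
    exact ⟨m, by omega, h⟩
  have h1 := Finset.card_le_card this
  have h2 := Finset.card_image_le (s := Finset.range (T.depth v + 1)) (f := fun m => T.parent^[m] v)
  rw [Finset.card_range] at h2
  omega

lemma cov_eq (ℓ : T.V → ℝ) {w i j : T.V} (hi : w ∈ T.ancSelf i) (hj : w ∉ T.ancSelf j) :
    T.cov ℓ j i = T.cov ℓ j w := by
  unfold cov
  congr 1
  ext x
  simp only [edgesToRoot, Finset.mem_inter, Finset.mem_erase]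
  constructor
  · rintro ⟨⟨h0, h1⟩, _, h2⟩
    refine ⟨⟨h0, h1⟩, h0, ?_⟩
    rcases T.anc_total h2 hi with h | h
    · exact h
    · exact absurd (T.anc_trans h h1) hj
  · rintro ⟨⟨h0, h1⟩, _, h2⟩
    exact ⟨⟨h0, h1⟩, h0, T.anc_trans h2 hi⟩

lemma child_disjoint {v x y : T.V} (hx : x ∈ T.children v) (hy : y ∈ T.children v)
    (hxy : x ≠ y) : Disjoint (T.leavesBelow x) (T.leavesBelow y) := by
  rw [Finset.disjoint_left]
  intro i h1 h2
  simp only [leavesBelow, Finset.mem_filter] at h1 h2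
  simp only [children, Finset.mem_filter] at hx hy
  have e1 := T.depth_parent x hx.2.1
  have e2 := T.depth_parent y hy.2.1
  rw [hx.2.2] at e1
  rw [hy.2.2] at e2
  rcases T.anc_total h1.2 h2.2 with h | h
  · exact hxy (T.anc_depth_eq h (by omega))
  · exact hxy (T.anc_depth_eq h (by omega)).symm

lemma below_child {v x i : T.V} (hx : x ∈ T.children v) (hi : i ∈ T.leavesBelow x) :
    v ∈ T.ancSelf i := by
  simp only [leavesBelow, Finset.mem_filter] at hi
  simp only [children, Finset.mem_filter] at hx
  exact T.anc_trans (T.mem_anc.2 ⟨1, hx.2.2⟩) hi.2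

/-- Ordered pairs of comparable interior nodes. -/
def cmpPairs : Finset (T.V × T.V) :=
  (T.interior ×ˢ T.interior).filter fun p => p.1 ∈ T.ancSelf p.2 ∨ p.2 ∈ T.ancSelf p.1

lemma card_cmpPairs : T.cmpPairs.card ≤ T.interior.card + 2 * T.IPL := by
  have hsub : T.cmpPairs ⊆ T.interior.image (fun v => (v, v)) ∪
      ((T.interior.sigma fun v => (T.ancSelf v).erase v).image (fun p => (p.1, p.2)) ∪
       (T.interior.sigma fun v => (T.ancSelf v).erase v).image (fun p => (p.2, p.1))) := by
    rintro ⟨u, v⟩ h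
    simp only [cmpPairs, Finset.mem_filter, Finset.mem_product] at h
    obtain ⟨⟨hu, hv⟩, h⟩ := h
    simp only [Finset.mem_union, Finset.mem_image, Finset.mem_sigma, Finset.mem_erase]
    by_cases huv : u = v
    · left; exact ⟨u, hu, by rw [huv]⟩
    · right
      rcases h with h | h
      · right; exact ⟨⟨v, u⟩, ⟨hv, huv, h⟩, rfl⟩
      · left; exact ⟨⟨u, v⟩, ⟨hu, fun e => huv e.symm, h⟩, rfl⟩
  have hs : (T.interior.sigma fun v => (T.ancSelf v).erase v).card ≤ T.IPL := by
    rw [Finset.card_sigma]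
    exact Finset.sum_le_sum fun v _ => T.card_anc_le v
  refine (Finset.card_le_card hsub).trans ?_
  refine (Finset.card_union_le _ _).trans ?_
  have h1 := Finset.card_image_le (s := T.interior) (f := fun v => (v, v))
  have h2 := Finset.card_union_le
    ((T.interior.sigma fun v => (T.ancSelf v).erase v).image (fun p => (p.1, p.2)))
    ((T.interior.sigma fun v => (T.ancSelf v).erase v).image (fun p => (p.2, p.1)))
  have h3 := Finset.card_image_le (s := T.interior.sigma fun v => (T.ancSelf v).erase v)
    (f := fun p => (p.1, p.2))
  have h4 := Finset.card_image_le (s := T.interior.sigma fun v => (T.ancSelf v).erase v)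
    (f := fun p => (p.2, p.1))
  omega

/-- The node of a wavelet index. -/
def nodeOf : Option (T.V × ℕ) → T.V
  | none => T.root
  | some p => p.1

lemma card_fiber (k : ℕ) (hk : 2 ≤ k) (v : T.V) :
    ((T.waveletIdx k).filter fun a => T.nodeOf a = v).card ≤ k - 1 := by
  by_cases hv : v = T.root
  · refine le_trans (b := 1) ?_ (by omega)
    rw [Finset.card_le_one_iff_subset_singleton]
    refine ⟨none, ?_⟩
    intro a ha
    simp only [waveletIdx, Finset.mem_filter, Finset.mem_insert, Finset.mem_image,
      Finset.mem_product, Finset.mem_erase] at ha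
    obtain ⟨h1 | ⟨p, hp, rfl⟩, h2⟩ := ha
    · simp [h1]
    · exact absurd (h2.trans hv) hp.1.1
  · have : ((T.waveletIdx k).filter fun a => T.nodeOf a = v) ⊆
        (Finset.Ico 1 k).image (fun n => some (v, n)) := by
      intro a ha
      simp only [waveletIdx, Finset.mem_filter, Finset.mem_insert, Finset.mem_image,
        Finset.mem_product, Finset.mem_erase] at ha
      obtain ⟨h1 | ⟨p, hp, rfl⟩, h2⟩ := ha
      · rw [h1] at h2; exact absurd h2.symm hv
      · rw [Finset.mem_image]
        refine ⟨p.2, hp.2, ?_⟩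
        rw [← h2]; rfl
    refine (Finset.card_le_card this).trans (Finset.card_image_le.trans ?_)
    simp

end FinRootedTree

namespace KRegStruct

variable {k : ℕ} {T : FinRootedTree}

lemma root_not_leaf (R : KRegStruct k T) : ¬ T.IsLeaf T.root := by
  intro h
  have := R.root_deg
  rw [FinRootedTree.IsLeaf] at h
  rw [h] at this
  simp at this

lemma root_mem (R : KRegStruct k T) : T.root ∈ T.interior := by
  simp [FinRootedTree.interior, R.root_not_leaf]

lemma card_children (R : KRegStruct k T) (v : T.V) (h0 : v ≠ T.root) (hl : ¬ T.IsLeaf v) :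
    (T.children v).card = k := by
  have : T.children v = (Finset.range k).image (R.child v) := by
    ext u
    simp only [Finset.mem_image, Finset.mem_range]
    constructor
    · intro h
      exact R.child_surj v h0 hl u h
    · rintro ⟨i, hi, rfl⟩
      exact R.child_mem v h0 hl i hi
  rw [this, Finset.card_image_of_injOn, Finset.card_range]
  intro i hi j hj hij
  exact R.child_inj v h0 hl i (by simpa using hi) j (by simpa using hj) hij

lemma card_leaves (R : KRegStruct k T) : T.leaves.card + (T.interior.card + k) = 2 + T.interior.card * k := by
  have h1 : T.leaves.card + T.interior.card = Fintype.card T.V := by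
    unfold FinRootedTree.leaves FinRootedTree.interior
    rw [Finset.card_filter_add_card_filter_not, Finset.card_univ]
  have h2 : (Finset.univ.erase T.root).card = ∑ v : T.V, (T.children v).card := by
    rw [Finset.card_eq_sum_card_fiberwise (f := T.parent) (t := Finset.univ) (by intro x _; simp)]
    refine Finset.sum_congr rfl fun v _ => ?_
    congr 1
    ext u
    simp [FinRootedTree.children]
  have h3 : ∑ v : T.V, (T.children v).card = ∑ v ∈ T.interior, (T.children v).card := by
    symm
    apply Finset.sum_subset (Finset.subset_univ _)
    intro x _ hx
    have : T.IsLeaf x := by simpa [FinRootedTree.interior] using hx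
    rw [FinRootedTree.IsLeaf] at this
    rw [this]; rfl
  have h4 : ∑ v ∈ T.interior, (T.children v).card = (T.interior.card - 1) * k + 1 := by
    rw [← Finset.sum_erase_add _ _ R.root_mem, R.root_deg,
      Finset.sum_congr rfl (g := fun _ => k), Finset.sum_const,
      Finset.card_erase_of_mem R.root_mem, smul_eq_mul]
    intro v hv
    rw [Finset.mem_erase] at hv
    exact R.card_children v hv.1 (by simpa [FinRootedTree.interior] using hv.2)
  rw [Finset.card_erase_of_mem (Finset.mem_univ _), Finset.card_univ] at h2
  have hpos : 0 < T.interior.card := Finset.card_pos.2 ⟨_, R.root_mem⟩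
  have hV : 0 < Fintype.card T.V := Fintype.card_pos_iff.2 ⟨T.root⟩
  obtain ⟨d, hd⟩ : ∃ d, T.interior.card = d + 1 := ⟨T.interior.card - 1, by omega⟩
  rw [hd] at h1 h4 ⊢
  have : (d + 1) * k = d * k + k := by ring
  rw [Nat.add_sub_cancel] at h4
  omega

lemma card_idx (R : KRegStruct k T) (hk : 2 ≤ k) : (T.waveletIdx k).card = T.leaves.card := by
  have h := R.card_leaves
  have hpos : 0 < T.interior.card := Finset.card_pos.2 ⟨_, R.root_mem⟩
  unfold FinRootedTree.waveletIdx
  rw [Finset.card_insert_of_notMem (by simp),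
    Finset.card_image_of_injective _ (Option.some_injective _), Finset.card_product,
    Finset.card_erase_of_mem R.root_mem, Nat.card_Ico]
  obtain ⟨d, hd⟩ : ∃ d, T.interior.card = d + 1 := ⟨T.interior.card - 1, by omega⟩
  obtain ⟨m, rfl⟩ : ∃ m, k = m + 1 := ⟨k - 1, by omega⟩
  rw [hd] at h ⊢
  simp only [Nat.add_sub_cancel]
  nlinarith

lemma interior_le (R : KRegStruct k T) (hk : 2 ≤ k) : T.interior.card ≤ T.leaves.card := by
  have h := R.card_leaves
  have hpos : 0 < T.interior.card := Finset.card_pos.2 ⟨_, R.root_mem⟩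
  obtain ⟨d, hd⟩ : ∃ d, T.interior.card = d + 1 := ⟨T.interior.card - 1, by omega⟩
  obtain ⟨m, rfl⟩ : ∃ m, k = m + 2 := ⟨k - 2, by omega⟩
  rw [hd] at h ⊢
  nlinarith [Nat.zero_le (d * m)]

lemma wavelet_supp (R : KRegStruct k T) {v : T.V} (h0 : v ≠ T.root) (hl : ¬ T.IsLeaf v) {n : ℕ} (hn : n < k)
    {i : T.V} (hi : R.wavelet v n i ≠ 0) : v ∈ T.ancSelf i := by
  unfold wavelet at hi
  split_ifs at hi with h1 h2
  · simp only [Lpart, Finset.mem_biUnion, Finset.mem_range] at h1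
    obtain ⟨j, hj, h1⟩ := h1
    exact T.below_child (R.child_mem v h0 hl j (by omega)) h1
  · exact T.below_child (R.child_mem v h0 hl n hn) h2
  · exact absurd rfl hi

lemma sqrt_aux (a b c : ℝ) (ha : 0 ≤ a) (hb : 0 ≤ b) :
    a * Real.sqrt (b / (a * c)) = Real.sqrt a * Real.sqrt b / Real.sqrt c := by
  rw [Real.sqrt_div hb, Real.sqrt_mul ha]
  rcases ha.eq_or_lt with h | h
  · subst h; simp
  · have hs := Real.sqrt_pos.2 h
    have : a = Real.sqrt a * Real.sqrt a := (Real.mul_self_sqrt ha).symm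
    nth_rewrite 1 [this]
    rw [mul_div_assoc', mul_assoc, mul_div_mul_left _ _ hs.ne']

lemma wavelet_sum (R : KRegStruct k T) {v : T.V} (h0 : v ≠ T.root) (hl : ¬ T.IsLeaf v) {n : ℕ} (hn : n < k) :
    ∑ i ∈ T.leaves, R.wavelet v n i = 0 := by
  have hdis : Disjoint (R.Lpart v n) (R.Lnext v n) := by
    rw [Lpart, Finset.disjoint_biUnion_left]
    intro j hj
    rw [Finset.mem_range] at hj
    refine T.child_disjoint (R.child_mem v h0 hl j (by omega)) (R.child_mem v h0 hl n hn) ?_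
    intro e
    have := R.child_inj v h0 hl j (by omega) n hn e
    omega
  have hsub : R.Lpart v n ∪ R.Lnext v n ⊆ T.leaves := by
    intro i hi
    simp only [Lpart, Lnext, FinRootedTree.leavesBelow, Finset.mem_union, Finset.mem_biUnion,
      Finset.mem_filter] at hi
    rcases hi with ⟨_, _, h, _⟩ | ⟨h, _⟩ <;> exact h
  rw [← Finset.sum_subset hsub, Finset.sum_union hdis]
  · rw [Finset.sum_congr rfl (fun i hi => show R.wavelet v n i = _ from if_pos hi),
      Finset.sum_congr (s₁ := R.Lnext v n) rfl (fun i hi => show R.wavelet v n i = _ from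
        (if_neg (Finset.disjoint_right.1 hdis hi)).trans (if_pos hi))]
    rw [Finset.sum_const, Finset.sum_const, nsmul_eq_mul, nsmul_eq_mul, mul_neg,
      sqrt_aux _ _ _ (Nat.cast_nonneg _) (Nat.cast_nonneg _),
      sqrt_aux _ _ _ (Nat.cast_nonneg _) (Nat.cast_nonneg _)]
    ring
  · intro i _ hi
    rw [Finset.mem_union, not_or] at hi
    unfold wavelet
    rw [if_neg hi.1, if_neg hi.2]

lemma entry_zero (R : KRegStruct k T) (ℓ : T.V → ℝ) {a b : Option (T.V × ℕ)} (ha : a ∈ T.waveletIdx k)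
    (hb : b ∈ T.waveletIdx k) (h1 : T.nodeOf a ∉ T.ancSelf (T.nodeOf b))
    (h2 : T.nodeOf b ∉ T.ancSelf (T.nodeOf a)) : R.entry ℓ a b = 0 := by
  simp only [FinRootedTree.waveletIdx, Finset.mem_insert, Finset.mem_image,
    Finset.mem_product, Finset.mem_erase, FinRootedTree.interior, Finset.mem_filter,
    Finset.mem_univ, true_and, Finset.mem_Ico] at ha hb
  obtain rfl | ⟨⟨v, n⟩, ⟨⟨hv0, hvl⟩, _, hn⟩, rfl⟩ := ha
  · exact absurd (T.root_anc _) h1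
  obtain rfl | ⟨⟨w, m⟩, ⟨⟨hw0, hwl⟩, _, hm⟩, rfl⟩ := hb
  · exact absurd (T.root_anc _) h2
  simp only [FinRootedTree.nodeOf] at h1 h2
  simp only at hv0 hvl hn hw0 hwl hm
  unfold entry
  refine Finset.sum_eq_zero fun j _ => ?_
  simp only [waveFun]
  by_cases hj : R.wavelet v n j = 0
  · simp [hj]
  have hvj := R.wavelet_supp hv0 hvl hn hj
  have hwj : w ∉ T.ancSelf j := by
    intro h
    rcases T.anc_total hvj h with h | h
    · exact h1 h
    · exact h2 h
  have : ∀ i ∈ T.leaves, R.wavelet v n j * T.cov ℓ j i * R.wavelet w m i =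
      R.wavelet v n j * T.cov ℓ j w * R.wavelet w m i := by
    intro i _
    by_cases hi : R.wavelet w m i = 0
    · simp [hi]
    · rw [T.cov_eq ℓ (R.wavelet_supp hw0 hwl hm hi) hwj]
  rw [Finset.sum_congr rfl this, ← Finset.mul_sum, R.wavelet_sum hw0 hwl hm, mul_zero]

lemma node_interior (R : KRegStruct k T) {a : Option (T.V × ℕ)} (ha : a ∈ T.waveletIdx k) :
    T.nodeOf a ∈ T.interior := by
  simp only [FinRootedTree.waveletIdx, Finset.mem_insert, Finset.mem_image,
    Finset.mem_product, Finset.mem_erase] at ha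
  obtain rfl | ⟨p, hp, rfl⟩ := ha
  · exact R.root_mem
  · exact hp.1.2

open Classical in
lemma card_nonzero (R : KRegStruct k T) (hk : 2 ≤ k) (ℓ : T.V → ℝ) :
    ((T.waveletIdx k ×ˢ T.waveletIdx k).filter fun p => ¬ R.entry ℓ p.1 p.2 = 0).card ≤
      (k - 1) ^ 2 * (T.interior.card + 2 * T.IPL) := by
  refine le_trans ?_ (Nat.mul_le_mul_left _ T.card_cmpPairs)
  apply Finset.card_le_mul_card_image_of_maps_to
    (f := fun p => (T.nodeOf p.1, T.nodeOf p.2))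
  · rintro ⟨a, b⟩ h
    simp only [Finset.mem_filter, Finset.mem_product] at h
    obtain ⟨⟨ha, hb⟩, h⟩ := h
    simp only [FinRootedTree.cmpPairs, Finset.mem_filter, Finset.mem_product]
    refine ⟨⟨R.node_interior ha, R.node_interior hb⟩, ?_⟩
    by_contra hc
    rw [not_or] at hc
    exact h (R.entry_zero ℓ ha hb hc.1 hc.2)
  · rintro ⟨u, v⟩ _
    have : (((T.waveletIdx k ×ˢ T.waveletIdx k).filter fun p => ¬ R.entry ℓ p.1 p.2 = 0).filter
        fun p => (T.nodeOf p.1, T.nodeOf p.2) = (u, v)) ⊆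
        ((T.waveletIdx k).filter fun a => T.nodeOf a = u) ×ˢ
        ((T.waveletIdx k).filter fun a => T.nodeOf a = v) := by
      rintro ⟨a, b⟩ h
      simp only [Finset.mem_filter, Finset.mem_product, Prod.mk.injEq] at h ⊢
      exact ⟨⟨h.1.1.1, h.2.1⟩, h.1.1.2, h.2.2⟩
    refine (Finset.card_le_card this).trans ?_
    rw [Finset.card_product, sq]
    exact Nat.mul_le_mul (T.card_fiber k hk u) (T.card_fiber k hk v)

end KRegStruct

/-- For a `k`-regular tree, the fraction `ζ` of vanishing
entries of `Φ' C Φ` satisfies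
`1 - ζ ≤ (k-1)²/|I| + 2 (k-1)² IPL(T)/|I|²`. -/
theorem one_sub_zeta_le (k : ℕ) (hk : 2 ≤ k) (T : FinRootedTree)
    (R : KRegStruct k T) (ℓ : T.V → ℝ) (hℓ : ∀ w : T.V, w ≠ T.root → 0 < ℓ w) :
    1 - R.zeta ℓ ≤
      ((k : ℝ) - 1) ^ 2 / (T.interior.card : ℝ) +
        2 * ((k : ℝ) - 1) ^ 2 * (T.IPL : ℝ) / ((T.interior.card : ℝ)) ^ 2 := by
  classical
  have hnz := R.card_nonzero hk ℓ
  have hsplit := Finset.card_filter_add_card_filter_not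
    (s := T.waveletIdx k ×ˢ T.waveletIdx k) (fun p => R.entry ℓ p.1 p.2 = 0)
  rw [Finset.card_product, R.card_idx hk] at hsplit
  have hIL := R.interior_le hk
  have hpos : 0 < T.interior.card := Finset.card_pos.2 ⟨_, R.root_mem⟩
  unfold KRegStruct.zeta
  generalize hz : ((T.waveletIdx k ×ˢ T.waveletIdx k).filter
    fun p => R.entry ℓ p.1 p.2 = 0).card = z at *
  generalize ((T.waveletIdx k ×ˢ T.waveletIdx k).filter
    fun p => ¬ R.entry ℓ p.1 p.2 = 0).card = y at *
  have hzz : (((T.waveletIdx k ×ˢ T.waveletIdx k).filter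
    fun p => R.entry ℓ p.1 p.2 = 0).card : ℝ) = z := by
    rw [← hz]
  have hk1 : ((k - 1 : ℕ) : ℝ) = (k : ℝ) - 1 := by
    rw [Nat.cast_sub (by omega)]; simp
  have e1 : (z : ℝ) + y = (T.leaves.card : ℝ) * T.leaves.card := by exact_mod_cast hsplit
  have e2 : (y : ℝ) ≤ ((k : ℝ) - 1) ^ 2 * (T.interior.card + 2 * T.IPL) := by
    rw [← hk1]; exact_mod_cast hnz
  have e3 : (T.interior.card : ℝ) ≤ T.leaves.card := by exact_mod_cast hIL
  have e4 : (0 : ℝ) < T.interior.card := by exact_mod_cast hpos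
  have e5 : (0 : ℝ) < T.leaves.card := by linarith
  calc 1 - (z : ℝ) / (T.leaves.card : ℝ) ^ 2 = y / (T.leaves.card : ℝ) ^ 2 := by
        field_simp
        linarith
    _ ≤ (((k : ℝ) - 1) ^ 2 * (T.interior.card + 2 * T.IPL)) / (T.interior.card : ℝ) ^ 2 := by
        gcongr
    _ = _ := by
        field_simp
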